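/- Let (X,T) be a nonautonomous dynamical system, E ⊂ X_0 a Borel set, s ∈ ℝ, μ a Borel probability measure on X_0, and f = (f_k) a sequence of continuous real-valued potentials. Then: (1) if P̲_μ(T,f,x) ≤ s for all x ∈ E, then P^B(T,f,E) ≤ s; and (2) if f is equicontinuous, P̲_μ(T,f,x) ≥ s for all x ∈ E, and μ(E) > 0, then P^B(T,f,E) ≥ s. -/

import Mathlib

open Filter MeasureTheory Set
open scoped ENNReal Topology

namespace NDS

variable {X : ℕ → Type*}

/-- Iterates `T^j : X 0 → X j` of a nonautonomous dynamical system `T`. -/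
def iter (T : ∀ k, X k → X (k + 1)) : ∀ j, X 0 → X j
  | 0 => fun x => x
  | j + 1 => fun x => T j (iter T j x)

/-- The Birkhoff-type sum `S_n^T f (x) = ∑_{j<n} f_j (T^j x)`. -/
def birk (T : ∀ k, X k → X (k + 1)) (f : ∀ k, X k → ℝ) (n : ℕ) (x : X 0) : ℝ :=
  ∑ j ∈ Finset.range n, f j (iter T j x)

/-- The uniform norm `‖f‖ = sup_k sup_x |f_k x|` of a sequence of potentials. -/
noncomputable def fnorm (f : ∀ k, X k → ℝ) : ℝ :=
  ⨆ k : ℕ, ⨆ x : X k, |f k x|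

/-- `log : ℝ≥0∞ → EReal` with the conventions `log 0 = -∞`, `log ∞ = ∞`. -/
noncomputable def elog (x : ℝ≥0∞) : EReal :=
  if x = 0 then ⊥ else if x = ⊤ then ⊤ else ((Real.log x.toReal : ℝ) : EReal)

/-- The nonnegative part of an extended real, as an element of `ℝ≥0∞`. -/
noncomputable def toENN (x : EReal) : ℝ≥0∞ :=
  if x = ⊤ then ⊤ else ENNReal.ofReal x.toReal

/-- The canonical map `ℝ≥0∞ → EReal`. -/
noncomputable def ofENN (x : ℝ≥0∞) : EReal :=
  if x = ⊤ then ⊤ else ((x.toReal : ℝ) : EReal)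

/-- The integral of an extended-real-valued function: the difference of the lower
integrals of its positive and negative parts. -/
noncomputable def eInt {α : Type*} [MeasurableSpace α] (μ : Measure α) (g : α → EReal) : EReal :=
  ofENN (∫⁻ x, toENN (g x) ∂μ) - ofENN (∫⁻ x, toENN (-g x) ∂μ)

section Metric

variable [∀ k, MetricSpace (X k)]

/-- The open Bowen ball `B_n^T(x,ε)`. -/
def bowenBall (T : ∀ k, X k → X (k + 1)) (n : ℕ) (ε : ℝ) (x : X 0) : Set (X 0) :=
  {y | ∀ j < n, dist (iter T j x) (iter T j y) < ε}

/-- The closed Bowen ball `B̄_n^T(x,ε)`. -/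
def bowenClosedBall (T : ∀ k, X k → X (k + 1)) (n : ℕ) (ε : ℝ) (x : X 0) : Set (X 0) :=
  {y | ∀ j < n, dist (iter T j x) (iter T j y) ≤ ε}

/-- Equicontinuity of a sequence of potentials `f = (f_k)`. -/
def EquicontPotential (f : ∀ k, X k → ℝ) : Prop :=
  ∀ ε : ℝ, 0 < ε → ∃ δ : ℝ, 0 < δ ∧ ∀ k, ∀ x y : X k, dist x y < δ → |f k x - f k y| < ε

/-- The supremum of the Birkhoff sum `S_n^T f` over a subset `A` of `X 0`. -/
noncomputable def supBirk (T : ∀ k, X k → X (k + 1)) (f : ∀ k, X k → ℝ) (n : ℕ)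
    (A : Set (X 0)) : ℝ :=
  ⨆ y : A, birk T f n (y : X 0)

/-- Measure-theoretic lower local pressure `P̲_μ(T,f,x)`. -/
noncomputable def localLowerPres [MeasurableSpace (X 0)] (μ : Measure (X 0))
    (T : ∀ k, X k → X (k + 1)) (f : ∀ k, X k → ℝ) (x : X 0) : EReal :=
  ⨆ (ε : ℝ) (_ : 0 < ε),
    liminf (fun n : ℕ =>
      (((n : ℝ)⁻¹ : ℝ) : EReal) *
        (-(elog (μ (bowenBall T n ε x))) + ((birk T f n x : ℝ) : EReal))) atTop

/-- Measure-theoretic upper local pressure `P̄_μ(T,f,x)`. -/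
noncomputable def localUpperPres [MeasurableSpace (X 0)] (μ : Measure (X 0))
    (T : ∀ k, X k → X (k + 1)) (f : ∀ k, X k → ℝ) (x : X 0) : EReal :=
  ⨆ (ε : ℝ) (_ : 0 < ε),
    limsup (fun n : ℕ =>
      (((n : ℝ)⁻¹ : ℝ) : EReal) *
        (-(elog (μ (bowenBall T n ε x))) + ((birk T f n x : ℝ) : EReal))) atTop

/-- Measure-theoretic lower local entropy `h̲_μ(T,x)`. -/
noncomputable def localLowerEnt [MeasurableSpace (X 0)] (μ : Measure (X 0))
    (T : ∀ k, X k → X (k + 1)) (x : X 0) : EReal :=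
  ⨆ (ε : ℝ) (_ : 0 < ε),
    liminf (fun n : ℕ =>
      (((n : ℝ)⁻¹ : ℝ) : EReal) * (-(elog (μ (bowenBall T n ε x))))) atTop

/-- Measure-theoretic upper local entropy `h̄_μ(T,x)`. -/
noncomputable def localUpperEnt [MeasurableSpace (X 0)] (μ : Measure (X 0))
    (T : ∀ k, X k → X (k + 1)) (x : X 0) : EReal :=
  ⨆ (ε : ℝ) (_ : 0 < ε),
    limsup (fun n : ℕ =>
      (((n : ℝ)⁻¹ : ℝ) : EReal) * (-(elog (μ (bowenBall T n ε x))))) atTop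

/-- Measure-theoretic lower pressure `P̲_μ(T,f) = ∫ P̲_μ(T,f,x) dμ(x)`. -/
noncomputable def lowerPres [MeasurableSpace (X 0)] (μ : Measure (X 0))
    (T : ∀ k, X k → X (k + 1)) (f : ∀ k, X k → ℝ) : EReal :=
  eInt μ (fun x => localLowerPres μ T f x)

/-- Measure-theoretic upper pressure `P̄_μ(T,f) = ∫ P̄_μ(T,f,x) dμ(x)`. -/
noncomputable def upperPres [MeasurableSpace (X 0)] (μ : Measure (X 0))
    (T : ∀ k, X k → X (k + 1)) (f : ∀ k, X k → ℝ) : EReal :=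
  eInt μ (fun x => localUpperPres μ T f x)

/-- Measure-theoretic lower entropy `h̲_μ(T) = ∫ h̲_μ(T,x) dμ(x)`. -/
noncomputable def lowerEnt [MeasurableSpace (X 0)] (μ : Measure (X 0))
    (T : ∀ k, X k → X (k + 1)) : EReal :=
  eInt μ (fun x => localLowerEnt μ T x)

/-- Measure-theoretic upper entropy `h̄_μ(T) = ∫ h̄_μ(T,x) dμ(x)`. -/
noncomputable def upperEnt [MeasurableSpace (X 0)] (μ : Measure (X 0))
    (T : ∀ k, X k → X (k + 1)) : EReal :=
  eInt μ (fun x => localUpperEnt μ T x)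

/-- The Bowen premeasure `M^s_{N,ε}(T,f,Z)`: the infimum of
`∑ exp(-n_i s + S_{n_i}^T f(x_i))` over all countable `(N,ε)`-covers of `Z` by open
Bowen balls `B_{n_i}^T(x_i,ε)` with `n_i ≥ N`. -/
noncomputable def bowenPre (T : ∀ k, X k → X (k + 1)) (f : ∀ k, X k → ℝ)
    (s : ℝ) (N : ℕ) (ε : ℝ) (Z : Set (X 0)) : ℝ≥0∞ :=
  ⨅ (D : Set (X 0 × ℕ)) (_ : D.Countable) (_ : ∀ p ∈ D, N ≤ p.2)
      (_ : Z ⊆ ⋃ p ∈ D, bowenBall T p.2 ε p.1),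
    ∑' p : D, ENNReal.ofReal (Real.exp (-(p.1.2 : ℝ) * s + birk T f p.1.2 p.1.1))

/-- `M^s_ε(T,f,Z) = lim_{N→∞} M^s_{N,ε}(T,f,Z)` (an increasing limit). -/
noncomputable def bowenPreLim (T : ∀ k, X k → X (k + 1)) (f : ∀ k, X k → ℝ)
    (s : ℝ) (ε : ℝ) (Z : Set (X 0)) : ℝ≥0∞ :=
  ⨆ N : ℕ, bowenPre T f s N ε Z

/-- The critical value `P^B(T,f,Z,ε) = inf {s : M^s_ε(T,f,Z) = 0}`. -/
noncomputable def bowenCrit (T : ∀ k, X k → X (k + 1)) (f : ∀ k, X k → ℝ)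
    (ε : ℝ) (Z : Set (X 0)) : EReal :=
  ⨅ (s : ℝ) (_ : bowenPreLim T f s ε Z = 0), (s : EReal)

/-- The Bowen (Pesin–Pitskel') topological pressure
`P^B(T,f,Z) = lim_{ε→0} P^B(T,f,Z,ε)` (an increasing limit as `ε ↓ 0`). -/
noncomputable def bowenP (T : ∀ k, X k → X (k + 1)) (f : ∀ k, X k → ℝ)
    (Z : Set (X 0)) : EReal :=
  ⨆ (ε : ℝ) (_ : 0 < ε), bowenCrit T f ε Z

/-- The Bowen topological entropy `h^B(T,Z) = P^B(T,0,Z)`. -/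
noncomputable def bowenEnt (T : ∀ k, X k → X (k + 1)) (Z : Set (X 0)) : EReal :=
  bowenP T (fun k => fun _ : X k => (0 : ℝ)) Z

/-- The premeasure `N^s_{N,ε}(T,f,Z)` using suprema of Birkhoff sums over the balls. -/
noncomputable def nBowenPre (T : ∀ k, X k → X (k + 1)) (f : ∀ k, X k → ℝ)
    (s : ℝ) (N : ℕ) (ε : ℝ) (Z : Set (X 0)) : ℝ≥0∞ :=
  ⨅ (D : Set (X 0 × ℕ)) (_ : D.Countable) (_ : ∀ p ∈ D, N ≤ p.2)
      (_ : Z ⊆ ⋃ p ∈ D, bowenBall T p.2 ε p.1),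
    ∑' p : D, ENNReal.ofReal
      (Real.exp (-(p.1.2 : ℝ) * s + supBirk T f p.1.2 (bowenBall T p.1.2 ε p.1.1)))

/-- `N^s_ε(T,f,Z) = lim_{N→∞} N^s_{N,ε}(T,f,Z)`. -/
noncomputable def nBowenPreLim (T : ∀ k, X k → X (k + 1)) (f : ∀ k, X k → ℝ)
    (s : ℝ) (ε : ℝ) (Z : Set (X 0)) : ℝ≥0∞ :=
  ⨆ N : ℕ, nBowenPre T f s N ε Z

/-- The critical value `Q^B(T,f,Z,ε) = inf {s : N^s_ε(T,f,Z) = 0}`. -/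
noncomputable def nBowenCrit (T : ∀ k, X k → X (k + 1)) (f : ∀ k, X k → ℝ)
    (ε : ℝ) (Z : Set (X 0)) : EReal :=
  ⨅ (s : ℝ) (_ : nBowenPreLim T f s ε Z = 0), (s : EReal)

/-- The weighted Bowen premeasure `W^s_{N,ε}(T,f,g)`: the infimum of
`∑ c_i exp(-n_i s + sup_{B_{n_i}^T(x_i,ε)} S_{n_i}^T f)` over all countable families
`{(B_{n_i}^T(x_i,ε), c_i)}` with `0 < c_i`, `n_i ≥ N` and `∑ c_i χ_{B_i} ≥ g`. -/
noncomputable def wBowenPre (T : ∀ k, X k → X (k + 1)) (f : ∀ k, X k → ℝ)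
    (s : ℝ) (N : ℕ) (ε : ℝ) (g : X 0 → ℝ) : ℝ≥0∞ :=
  ⨅ (D : Set ((X 0 × ℕ) × ℝ)) (_ : D.Countable)
      (_ : ∀ p ∈ D, N ≤ p.1.2 ∧ 0 < p.2)
      (_ : ∀ x : X 0, ENNReal.ofReal (g x) ≤
        ∑' p : D, (bowenBall T p.1.1.2 ε p.1.1.1).indicator
          (fun _ => ENNReal.ofReal p.1.2) x),
    ∑' p : D, ENNReal.ofReal p.1.2 *
      ENNReal.ofReal
        (Real.exp (-(p.1.1.2 : ℝ) * s + supBirk T f p.1.1.2 (bowenBall T p.1.1.2 ε p.1.1.1)))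

/-- `D` is a countable `(N,ε)`-packing of `Z`: the closed Bowen balls
`B̄_{n}^T(x,ε)`, `(x,n) ∈ D`, are pairwise disjoint with centers in `Z` and orders `≥ N`. -/
def IsPacking (T : ∀ k, X k → X (k + 1)) (N : ℕ) (ε : ℝ) (Z : Set (X 0))
    (D : Set (X 0 × ℕ)) : Prop :=
  D.Countable ∧ (∀ p ∈ D, p.1 ∈ Z ∧ N ≤ p.2) ∧
    ∀ p ∈ D, ∀ q ∈ D, p ≠ q →
      Disjoint (bowenClosedBall T p.2 ε p.1) (bowenClosedBall T q.2 ε q.1)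

/-- The packing premeasure `P^s_{N,ε}(T,f,Z)`: the supremum of
`∑ exp(-n_i s + S_{n_i}^T f(x_i))` over all countable `(N,ε)`-packings of `Z`. -/
noncomputable def packPre (T : ∀ k, X k → X (k + 1)) (f : ∀ k, X k → ℝ)
    (s : ℝ) (N : ℕ) (ε : ℝ) (Z : Set (X 0)) : ℝ≥0∞ :=
  ⨆ (D : Set (X 0 × ℕ)) (_ : IsPacking T N ε Z D),
    ∑' p : D, ENNReal.ofReal (Real.exp (-(p.1.2 : ℝ) * s + birk T f p.1.2 p.1.1))

/-- `P^s_{∞,ε}(T,f,Z) = lim_{N→∞} P^s_{N,ε}(T,f,Z)` (a decreasing limit). -/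
noncomputable def packPreInf (T : ∀ k, X k → X (k + 1)) (f : ∀ k, X k → ℝ)
    (s : ℝ) (ε : ℝ) (Z : Set (X 0)) : ℝ≥0∞ :=
  ⨅ N : ℕ, packPre T f s N ε Z

/-- The packing measure-like quantity
`P^s_ε(T,f,Z) = inf { ∑_i P^s_{∞,ε}(T,f,Z_i) : Z ⊆ ⋃_i Z_i }`. -/
noncomputable def packMeasure (T : ∀ k, X k → X (k + 1)) (f : ∀ k, X k → ℝ)
    (s : ℝ) (ε : ℝ) (Z : Set (X 0)) : ℝ≥0∞ :=
  ⨅ (Zs : ℕ → Set (X 0)) (_ : Z ⊆ ⋃ i, Zs i), ∑' i, packPreInf T f s ε (Zs i)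

/-- The critical value `P^P(T,f,Z,ε) = inf {s : P^s_ε(T,f,Z) = 0}`. -/
noncomputable def packCrit (T : ∀ k, X k → X (k + 1)) (f : ∀ k, X k → ℝ)
    (ε : ℝ) (Z : Set (X 0)) : EReal :=
  ⨅ (s : ℝ) (_ : packMeasure T f s ε Z = 0), (s : EReal)

/-- The packing topological pressure `P^P(T,f,Z) = lim_{ε→0} P^P(T,f,Z,ε)`. -/
noncomputable def packP (T : ∀ k, X k → X (k + 1)) (f : ∀ k, X k → ℝ)
    (Z : Set (X 0)) : EReal :=
  ⨆ (ε : ℝ) (_ : 0 < ε), packCrit T f ε Z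

/-- The packing topological entropy `h^P(T,Z) = P^P(T,0,Z)`. -/
noncomputable def packEnt (T : ∀ k, X k → X (k + 1)) (Z : Set (X 0)) : EReal :=
  packP T (fun k => fun _ : X k => (0 : ℝ)) Z

/-- The packing premeasure `Q^s_{N,ε}(T,f,Z)` using suprema of Birkhoff sums over the balls. -/
noncomputable def qPackPre (T : ∀ k, X k → X (k + 1)) (f : ∀ k, X k → ℝ)
    (s : ℝ) (N : ℕ) (ε : ℝ) (Z : Set (X 0)) : ℝ≥0∞ :=
  ⨆ (D : Set (X 0 × ℕ)) (_ : IsPacking T N ε Z D),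
    ∑' p : D, ENNReal.ofReal
      (Real.exp (-(p.1.2 : ℝ) * s + supBirk T f p.1.2 (bowenClosedBall T p.1.2 ε p.1.1)))

/-- `Q^s_{∞,ε}(T,f,Z) = lim_{N→∞} Q^s_{N,ε}(T,f,Z)`. -/
noncomputable def qPackPreInf (T : ∀ k, X k → X (k + 1)) (f : ∀ k, X k → ℝ)
    (s : ℝ) (ε : ℝ) (Z : Set (X 0)) : ℝ≥0∞ :=
  ⨅ N : ℕ, qPackPre T f s N ε Z

/-- `Q^s_ε(T,f,Z) = inf { ∑_i Q^s_{∞,ε}(T,f,Z_i) : Z ⊆ ⋃_i Z_i }`. -/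
noncomputable def qPackMeasure (T : ∀ k, X k → X (k + 1)) (f : ∀ k, X k → ℝ)
    (s : ℝ) (ε : ℝ) (Z : Set (X 0)) : ℝ≥0∞ :=
  ⨅ (Zs : ℕ → Set (X 0)) (_ : Z ⊆ ⋃ i, Zs i), ∑' i, qPackPreInf T f s ε (Zs i)

/-- The critical value `Q^P(T,f,Z,ε) = inf {s : Q^s_ε(T,f,Z) = 0}`. -/
noncomputable def qPackCrit (T : ∀ k, X k → X (k + 1)) (f : ∀ k, X k → ℝ)
    (ε : ℝ) (Z : Set (X 0)) : EReal :=
  ⨅ (s : ℝ) (_ : qPackMeasure T f s ε Z = 0), (s : EReal)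

end Metric

/-- The distance function of an explicitly given metric space structure. -/
def mdist {α : Type*} (m : MetricSpace α) (x y : α) : ℝ :=
  @dist α m.toPseudoMetricSpace.toDist x y

end NDS

namespace NDS

variable {X : ℕ → Type*}

/-- A lower bound on the `n`-th normalised local pressure is an upper bound on the measure of
the Bowen ball. -/
lemma le_inv_mul_neg_elog_add_iff {n : ℕ} (hn : 0 < n) {m : ℝ≥0∞} (hm : m ≠ ⊤) (b c : ℝ) :
    (c : EReal) ≤ (((n : ℝ)⁻¹ : ℝ) : EReal) * (-(elog m) + (b : EReal)) ↔
      m ≤ ENNReal.ofReal (Real.exp (-(n : ℝ) * c + b)) := by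
  have hn' : (0 : ℝ) < n := by exact_mod_cast hn
  by_cases h0 : m = 0
  · have : elog m = ⊥ := by simp [elog, h0]
    rw [this, EReal.neg_bot, EReal.top_add_coe, EReal.coe_mul_top_of_pos (inv_pos.mpr hn')]
    simp [h0]
  · have hpos : 0 < m.toReal := ENNReal.toReal_pos h0 hm
    have : elog m = ((Real.log m.toReal : ℝ) : EReal) := by simp [elog, h0, hm]
    rw [this, ← EReal.coe_neg, ← EReal.coe_add, ← EReal.coe_mul, EReal.coe_le_coe_iff,
      ENNReal.le_ofReal_iff_toReal_le hm (Real.exp_pos _).le, ← Real.log_le_iff_le_exp hpos,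
      le_inv_mul_iff₀ hn']
    constructor <;> intro h <;> linarith

lemma continuous_iter [∀ k, TopologicalSpace (X k)] {T : ∀ k, X k → X (k + 1)}
    (hT : ∀ k, Continuous (T k)) (j : ℕ) : Continuous (iter T j) := by
  induction j with
  | zero => exact continuous_id
  | succ j ih => exact (hT j).comp ih

section Metric

variable [∀ k, MetricSpace (X k)] {T : ∀ k, X k → X (k + 1)} {f : ∀ k, X k → ℝ}

lemma isOpen_bowenBall (hT : ∀ k, Continuous (T k)) (n : ℕ) (ε : ℝ) (x : X 0) :
    IsOpen (bowenBall T n ε x) := by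
  have : bowenBall T n ε x = ⋂ j ∈ Finset.range n, {y | dist (iter T j x) (iter T j y) < ε} := by
    ext y
    simp [bowenBall]
  rw [this]
  exact isOpen_biInter_finset fun j _ =>
    isOpen_lt (continuous_const.dist (continuous_iter hT j)) continuous_const

lemma mem_bowenBall_self (n : ℕ) {ε : ℝ} (hε : 0 < ε) (x : X 0) : x ∈ bowenBall T n ε x :=
  fun j _ => by simpa using hε

lemma bowenBall_mono (n : ℕ) {ε ε' : ℝ} (h : ε ≤ ε') (x : X 0) :
    bowenBall T n ε x ⊆ bowenBall T n ε' x :=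
  fun _ hy j hj => (hy j hj).trans_le h

lemma bowenBall_subset_bowenBall_two_mul {n : ℕ} {ε : ℝ} {x y : X 0}
    (hy : y ∈ bowenBall T n ε x) : bowenBall T n ε x ⊆ bowenBall T n (2 * ε) y := by
  intro z hz j hj
  have := dist_triangle_left (iter T j y) (iter T j z) (iter T j x)
  linarith [hy j hj, hz j hj]

/-- If two Bowen balls of the same radius meet, the ball of smaller order, enlarged three times,
contains the centre of the other one. -/
lemma mem_bowenBall_three_mul {m n : ℕ} (hmn : m ≤ n) {ε : ℝ} (hε : 0 < ε) {x y : X 0}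
    (h : (bowenBall T n ε x ∩ bowenBall T m ε y).Nonempty) :
    x ∈ bowenBall T m (3 * ε) y := by
  obtain ⟨z, hzx, hzy⟩ := h
  intro j hj
  have := dist_triangle_right (iter T j y) (iter T j x) (iter T j z)
  linarith [hzx j (hj.trans_le hmn), hzy j hj]

/-- A Vitali-type covering bound: if each `x ∈ E` has Bowen balls of arbitrarily large order
whose measure dominates `exp (-n s + S_n f x)`, then the Bowen premeasure of `E` at any larger
exponent is exponentially small. -/
lemma bowenPre_le_of_frequently [MeasurableSpace (X 0)] [BorelSpace (X 0)]
    (hT : ∀ k, Continuous (T k)) (μ : Measure (X 0)) [IsProbabilityMeasure μ]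
    {E : Set (X 0)} {s η ε : ℝ} (hη : 0 ≤ η) (hε : 0 < ε)
    (h : ∀ x ∈ E, ∃ᶠ n : ℕ in atTop,
      ENNReal.ofReal (Real.exp (-(n : ℝ) * s + birk T f n x)) ≤ μ (bowenBall T n ε x))
    (N : ℕ) :
    bowenPre T f (s + η) N (3 * ε) E ≤ ENNReal.ofReal (Real.exp (-(N : ℝ) * η)) := by
  let B : X 0 × ℕ → Set (X 0) := fun p => bowenBall T p.2 ε p.1
  let t : Set (X 0 × ℕ) := {p | N ≤ p.2 ∧
    ENNReal.ofReal (Real.exp (-(p.2 : ℝ) * s + birk T f p.2 p.1)) ≤ μ (B p)}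
  obtain ⟨u, hut, hdisj, hcov⟩ := Vitali.exists_disjoint_subfamily_covering_enlargement B t
    (fun p => (1 / 4 : ℝ) ^ p.2) 2 one_lt_two (fun p _ => by positivity) 1
    (fun p _ => pow_le_one₀ (by norm_num) (by norm_num))
    (fun p _ => ⟨p.1, mem_bowenBall_self p.2 hε p.1⟩)
  have hmeas : ∀ p, MeasurableSet (B p) := fun p => (isOpen_bowenBall hT _ _ _).measurableSet
  have hdisj' : Pairwise (Function.onFun Disjoint fun p : u => B p) :=
    fun p q hpq => hdisj p.2 q.2 (Subtype.coe_ne_coe.mpr hpq)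
  have hcount : u.Countable := by
    have hpos := Measure.countable_meas_pos_of_disjoint_iUnion (μ := μ)
      (As := fun p : u => B p) (fun p => hmeas p) hdisj'
    have huniv : {p : u | 0 < μ (B p)} = univ := eq_univ_of_forall fun p =>
      (ENNReal.ofReal_pos.mpr (Real.exp_pos _)).trans_le (hut p.2).2
    rw [huniv, countable_univ_iff] at hpos
    exact hpos
  have hsum : ∑' p : u, μ (B p) ≤ 1 :=
    (tsum_meas_le_meas_iUnion_of_disjoint (As := fun p : u => B p) μ (fun p => hmeas p)
      hdisj').trans prob_le_one
  have hE : E ⊆ ⋃ p ∈ u, bowenBall T p.2 (3 * ε) p.1 := by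
    intro x hx
    obtain ⟨n, hNn, hn⟩ := frequently_atTop.mp (h x hx) N
    obtain ⟨q, hq, hne, hle⟩ := hcov (x, n) ⟨hNn, hn⟩
    have hqn : q.2 ≤ n := by
      by_contra! hlt
      have h1 : (1 / 4 : ℝ) ^ q.2 ≤ (1 / 4) ^ (n + 1) :=
        pow_le_pow_of_le_one (by norm_num) (by norm_num) hlt
      have h2 : (0 : ℝ) < (1 / 4) ^ n := by positivity
      rw [pow_succ] at h1
      simp only at hle
      linarith
    exact mem_biUnion hq (mem_bowenBall_three_mul hqn hε hne)
  calc bowenPre T f (s + η) N (3 * ε) E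
      ≤ ∑' p : u, ENNReal.ofReal (Real.exp (-(p.1.2 : ℝ) * (s + η) + birk T f p.1.2 p.1.1)) :=
        iInf₂_le_of_le u hcount (iInf₂_le_of_le (fun p hp => (hut hp).1) hE le_rfl)
    _ ≤ ∑' p : u, ENNReal.ofReal (Real.exp (-(N : ℝ) * η)) * μ (B p) := by
        refine ENNReal.tsum_le_tsum fun p => ?_
        refine le_trans ?_ (mul_le_mul_right (hut p.2).2 _)
        rw [← ENNReal.ofReal_mul (Real.exp_pos _).le, ← Real.exp_add]
        refine ENNReal.ofReal_le_ofReal (Real.exp_le_exp.mpr ?_)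
        have hN : (N : ℝ) ≤ p.1.2 := by exact_mod_cast (hut p.2).1
        linarith [mul_le_mul_of_nonneg_right hN hη]
    _ = ENNReal.ofReal (Real.exp (-(N : ℝ) * η)) * ∑' p : u, μ (B p) := ENNReal.tsum_mul_left
    _ ≤ ENNReal.ofReal (Real.exp (-(N : ℝ) * η)) := mul_le_of_le_one_right' hsum

lemma bowenPre_mono_order (s ε : ℝ) (Z : Set (X 0)) :
    Monotone fun N => bowenPre T f s N ε Z := fun _ _ hMN =>
  iInf_mono fun _ => iInf_mono fun _ =>
    iInf_mono' fun hN => ⟨fun p hp => hMN.trans (hN p hp), le_rfl⟩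

lemma bowenP_le_of_localLowerPres_le [MeasurableSpace (X 0)] [BorelSpace (X 0)]
    (hT : ∀ k, Continuous (T k)) (μ : Measure (X 0)) [IsProbabilityMeasure μ]
    {E : Set (X 0)} {s : ℝ} (h : ∀ x ∈ E, localLowerPres μ T f x ≤ (s : EReal)) :
    bowenP T f E ≤ (s : EReal) := by
  refine iSup₂_le fun ε hε => EReal.le_of_forall_lt_iff_le.mp fun t hst => ?_
  rw [EReal.coe_lt_coe_iff] at hst
  set η := (t - s) / 2 with hη
  have hη0 : 0 < η := by linarith
  have hfreq : ∀ x ∈ E, ∃ᶠ n : ℕ in atTop,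
      ENNReal.ofReal (Real.exp (-(n : ℝ) * (s + η) + birk T f n x)) ≤
        μ (bowenBall T n (ε / 3) x) := by
    intro x hx
    have hlt : ((s : ℝ) : EReal) < ((s + η : ℝ) : EReal) := by
      rw [EReal.coe_lt_coe_iff]; linarith
    have hlim := ((le_iSup₂ (f := fun (ε : ℝ) (_ : 0 < ε) => liminf (fun n : ℕ =>
      (((n : ℝ)⁻¹ : ℝ) : EReal) * (-(elog (μ (bowenBall T n ε x))) +
        ((birk T f n x : ℝ) : EReal))) atTop) (ε / 3) (by positivity)).trans (h x hx)).trans_lt hlt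
    refine ((frequently_lt_of_liminf_lt (by isBoundedDefault) hlim).and_eventually
      (eventually_gt_atTop 0)).mono fun n hn => ?_
    have := (le_inv_mul_neg_elog_add_iff hn.2 (measure_ne_top μ _) _ _).not.mp hn.1.not_ge
    exact (not_le.mp this).le
  have hle := bowenPre_le_of_frequently (f := f) hT μ hη0.le (by positivity) hfreq
  rw [show s + η + η = t by rw [hη]; ring, show 3 * (ε / 3) = ε by ring] at hle
  have htend : Tendsto (fun N : ℕ => ENNReal.ofReal (Real.exp (-(N : ℝ) * η))) atTop (𝓝 0) := by
    rw [← ENNReal.ofReal_zero]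
    refine ENNReal.tendsto_ofReal (Real.tendsto_exp_atBot.comp ?_)
    exact (tendsto_neg_atTop_atBot.comp tendsto_natCast_atTop_atTop).atBot_mul_const hη0
  refine iInf₂_le t (ENNReal.iSup_eq_zero.mpr fun N => ?_)
  refine le_antisymm (ge_of_tendsto htend ?_) zero_le
  filter_upwards [eventually_ge_atTop N] with M hM
  exact (bowenPre_mono_order t ε E hM).trans (hle M)

lemma birk_le_add_of_mem_bowenBall {δ η : ℝ}
    (hf : ∀ k, ∀ x y : X k, dist x y < δ → |f k x - f k y| < η) {n : ℕ} {x y : X 0}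
    (hy : y ∈ bowenBall T n δ x) : birk T f n y ≤ birk T f n x + n * η := by
  have : ∑ j ∈ Finset.range n, f j (iter T j y) ≤
      ∑ j ∈ Finset.range n, (f j (iter T j x) + η) := by
    refine Finset.sum_le_sum fun j hj => ?_
    have := (abs_lt.mp (hf j _ _ (hy j (Finset.mem_range.mp hj)))).1
    linarith
  simpa [birk, Finset.sum_add_distrib] using this

/-- A mass distribution principle: if the Bowen balls around points of `A` have measure at most
`exp (-n s + S_n f x)`, then the premeasure of `A` at a smaller exponent is at least `μ A`. -/
lemma measure_le_bowenPre [MeasurableSpace (X 0)] (μ : Measure (X 0)) {A E : Set (X 0)}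
    (hAE : A ⊆ E) {s t η ε : ℝ} {N : ℕ}
    (hf : ∀ k, ∀ x y : X k, dist x y < ε → |f k x - f k y| < η) (hts : t + η ≤ s)
    (h : ∀ x ∈ A, ∀ n ≥ N,
      μ (bowenBall T n (2 * ε) x) ≤ ENNReal.ofReal (Real.exp (-(n : ℝ) * s + birk T f n x))) :
    μ A ≤ bowenPre T f t N ε E := by
  refine le_iInf₂ fun D hD => le_iInf₂ fun hN hcov => ?_
  have : Countable D := hD
  have hsub : A ⊆ ⋃ p : D, A ∩ bowenBall T p.1.2 ε p.1.1 := by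
    rw [← inter_iUnion, ← biUnion_eq_iUnion D fun p _ => bowenBall T p.2 ε p.1]
    exact subset_inter Subset.rfl (hAE.trans hcov)
  refine (measure_mono hsub).trans ((measure_iUnion_le _).trans
    (ENNReal.tsum_le_tsum fun p => ?_))
  rcases (A ∩ bowenBall T p.1.2 ε p.1.1).eq_empty_or_nonempty with he | ⟨y, hyA, hy⟩
  · simp [he]
  refine (measure_mono (inter_subset_right.trans (bowenBall_subset_bowenBall_two_mul hy))).trans
    ((h y hyA _ (hN p p.2)).trans (ENNReal.ofReal_le_ofReal (Real.exp_le_exp.mpr ?_)))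
  have h1 := birk_le_add_of_mem_bowenBall hf hy
  have h2 := mul_le_mul_of_nonneg_left hts (Nat.cast_nonneg (α := ℝ) p.1.2)
  linarith

lemma le_bowenP_of_le_localLowerPres [MeasurableSpace (X 0)] (μ : Measure (X 0))
    [IsFiniteMeasure μ] (hf : EquicontPotential f) {E : Set (X 0)} {s : ℝ}
    (h : ∀ x ∈ E, (s : EReal) ≤ localLowerPres μ T f x) (hE : 0 < μ E) :
    (s : EReal) ≤ bowenP T f E := by
  refine EReal.ge_of_forall_gt_iff_ge.mp fun t hts => ?_
  rw [EReal.coe_lt_coe_iff] at hts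
  set η := (s - t) / 2 with hη
  have hη0 : 0 < η := by linarith
  let A : ℕ → Set (X 0) := fun k => {x ∈ E | ∀ n > k,
    μ (bowenBall T n (1 / ((k : ℝ) + 1)) x) ≤
      ENNReal.ofReal (Real.exp (-(n : ℝ) * (t + η) + birk T f n x))}
  have hcov : E ⊆ ⋃ k, A k := by
    intro x hx
    have hlt : ((t + η : ℝ) : EReal) < localLowerPres μ T f x :=
      (EReal.coe_lt_coe_iff.mpr (by linarith)).trans_le (h x hx)
    obtain ⟨ε, hlt⟩ := lt_iSup_iff.mp hlt
    obtain ⟨hε, hlt⟩ := lt_iSup_iff.mp hlt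
    obtain ⟨K, hK⟩ := eventually_atTop.mp (eventually_lt_of_lt_liminf hlt)
    obtain ⟨L, hL⟩ := exists_nat_one_div_lt hε
    refine mem_iUnion.mpr ⟨max K L, hx, fun n hn => ?_⟩
    have hball : bowenBall T n (1 / (((max K L : ℕ) : ℝ) + 1)) x ⊆ bowenBall T n ε x := by
      refine bowenBall_mono n ((one_div_le_one_div_of_le (by positivity) ?_).trans hL.le) x
      gcongr
      exact le_max_right K L
    refine (measure_mono hball).trans ((le_inv_mul_neg_elog_add_iff (by omega)
      (measure_ne_top μ _) _ _).mp (hK n (by omega)).le)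
  obtain ⟨k, hk⟩ : ∃ k, 0 < μ (A k) := by
    by_contra! hzero
    exact hE.ne' (measure_mono_null hcov (measure_iUnion_null fun k => le_zero_iff.mp (hzero k)))
  obtain ⟨δ, hδ, hfδ⟩ := hf η hη0
  set ε := min δ (1 / ((k : ℝ) + 1) / 2) with hε
  refine le_iSup₂_of_le ε (lt_min hδ (by positivity)) (le_iInf₂ fun r hr => ?_)
  rw [EReal.coe_le_coe_iff]
  by_contra! hrt
  refine hk.ne' (le_zero_iff.mp ?_)
  calc μ (A k) ≤ bowenPre T f r (k + 1) ε E :=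
        measure_le_bowenPre μ (sep_subset _ _) (s := t + η) (η := η)
          (fun j x y hxy => hfδ j x y (hxy.trans_le (min_le_left _ _))) (by linarith)
          fun x hx n hn => (measure_mono (bowenBall_mono n (by
            linarith [min_le_right δ (1 / ((k : ℝ) + 1) / 2)]) x)).trans (hx.2 n hn)
    _ ≤ bowenPreLim T f r ε E := le_iSup (fun N => bowenPre T f r N ε E) (k + 1)
    _ = 0 := hr

end Metric

end NDS

open NDS in
/-- Billingsley type theorem for the Bowen pressure.
(1) If `P̲_μ(T,f,x) ≤ s` for all `x ∈ E`, then `P^B(T,f,E) ≤ s`.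
(2) If `f` is equicontinuous, `P̲_μ(T,f,x) ≥ s` for all `x ∈ E` and `μ(E) > 0`,
then `P^B(T,f,E) ≥ s`. -/
theorem stmt1 {X : ℕ → Type*} [∀ k, MetricSpace (X k)] [∀ k, CompactSpace (X k)]
    [MeasurableSpace (X 0)] [BorelSpace (X 0)]
    (T : ∀ k, X k → X (k + 1)) (hT : ∀ k, Continuous (T k))
    (f : ∀ k, X k → ℝ) (hf : ∀ k, Continuous (f k))
    (E : Set (X 0)) (hE : MeasurableSet E) (s : ℝ)
    (μ : MeasureTheory.Measure (X 0)) [MeasureTheory.IsProbabilityMeasure μ] :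
    ((∀ x ∈ E, localLowerPres μ T f x ≤ (s : EReal)) → bowenP T f E ≤ (s : EReal)) ∧
    (EquicontPotential f → (∀ x ∈ E, (s : EReal) ≤ localLowerPres μ T f x) → 0 < μ E →
      (s : EReal) ≤ bowenP T f E) :=
  ⟨bowenP_le_of_localLowerPres_le hT μ, fun hfe => le_bowenP_of_le_localLowerPres μ hfe⟩
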